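/- Let μ > 0, L = 4/μ, A ∈ ℝ_{≥0}^{m×n} with every column nonzero, and f_μ(x) = 𝟙ᵀx + μΣ_{j=1}^m exp((1 − (Ax)_j)/μ). Fix x ∈ Δ and i ∈ [n]. If ∇_i f_μ(x) ≤ −1, then for every γ ∈ ℝ with |γ| ≤ 1/(L·‖A_{:i}‖_∞), one has ∇_i f_μ(x + γe_i) ≤ (1 − (L·‖A_{:i}‖_∞/2)·|γ|)·∇_i f_μ(x), where e_i is the i-th standard basis vector. -/

import Mathlib

/-- Coordinate-wise local Lipschitz continuity of the gradient (large-gradient case):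
if `∇_i f_μ(x) ≤ −1` and `|γ| ≤ 1/(L‖A_{:i}‖_∞)`, then
`∇_i f_μ(x + γe_i) ≤ (1 − (L‖A_{:i}‖_∞/2)|γ|)·∇_i f_μ(x)`. -/
theorem gradient_local_lipschitz_large
    (m n : ℕ) (μ L : ℝ) (hμ : 0 < μ) (hL : L = 4 / μ)
    (A : Matrix (Fin m) (Fin n) ℝ) (hA : ∀ j i, 0 ≤ A j i)
    (hcol : ∀ i, ∃ j, 0 < A j i)
    (Anorm : Fin n → ℝ)
    (hAnorm : ∀ i, IsGreatest {a : ℝ | ∃ j, A j i = a} (Anorm i))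
    (x : Fin n → ℝ) (hx : ∀ k, 0 ≤ x k ∧ x k ≤ 3 / Anorm k)
    (i : Fin n)
    (h1 : 1 - ∑ j, A j i * Real.exp ((1 - ∑ k, A j k * x k) / μ) ≤ -1)
    (γ : ℝ) (hγ : |γ| ≤ 1 / (L * Anorm i)) :
    1 - ∑ j, A j i * Real.exp ((1 - ∑ k, A j k * Function.update x i (x i + γ) k) / μ)
      ≤ (1 - (L * Anorm i / 2) * |γ|) *
        (1 - ∑ j, A j i * Real.exp ((1 - ∑ k, A j k * x k) / μ)) := by
  have hupd : ∀ j, ∑ k, A j k * Function.update x i (x i + γ) k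
      = ∑ k, A j k * x k + A j i * γ := by
    intro j
    rw [← Finset.add_sum_erase _ _ (Finset.mem_univ i),
      ← Finset.add_sum_erase (a := i) _ (fun k => A j k * x k) (Finset.mem_univ i),
      Finset.sum_congr rfl (g := fun k => A j k * x k)
        (fun k hk => by rw [Function.update_of_ne (Finset.ne_of_mem_erase hk)])]
    simp only [Function.update_self]
    ring
  have hle : ∀ j, A j i ≤ Anorm i := fun j => (hAnorm i).2 ⟨j, rfl⟩
  have hN : 0 ≤ Anorm i := by
    obtain ⟨j, hj⟩ := hcol i
    exact hj.le.trans (hle j)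
  set S := ∑ j, A j i * Real.exp ((1 - ∑ k, A j k * x k) / μ) with hS
  obtain ⟨t, ht⟩ : ∃ t, t = Anorm i * |γ| / μ := ⟨_, rfl⟩
  have ht0 : 0 ≤ t := by rw [ht]; positivity
  have hLt : L * Anorm i / 2 * |γ| = 2 * t := by rw [hL, ht]; ring
  have hsum : (1 - t) * S
      ≤ ∑ j, A j i * Real.exp ((1 - ∑ k, A j k * Function.update x i (x i + γ) k) / μ) := by
    rw [hS, Finset.mul_sum]
    refine Finset.sum_le_sum fun j _ => ?_
    have hexp : (1 - ∑ k, A j k * Function.update x i (x i + γ) k) / μ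
        = (1 - ∑ k, A j k * x k) / μ + -(A j i * γ / μ) := by
      rw [hupd]; ring
    have hstep : A j i * γ / μ ≤ t := by
      rw [ht]
      refine div_le_div_of_nonneg_right ?_ hμ.le
      exact (mul_le_mul_of_nonneg_left (le_abs_self γ) (hA j i)).trans
        (mul_le_mul_of_nonneg_right (hle j) (abs_nonneg γ))
    have hfac : 1 - t ≤ Real.exp (-(A j i * γ / μ)) := by
      linarith [Real.add_one_le_exp (-(A j i * γ / μ))]
    rw [hexp, Real.exp_add, ← mul_assoc (A j i), mul_comm (1 - t)]
    exact mul_le_mul_of_nonneg_left hfac (mul_nonneg (hA j i) (Real.exp_pos _).le)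
  rw [hLt]
  nlinarith [mul_nonneg ht0 (show 0 ≤ S - 2 by linarith)]
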